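/- Let C be a finitely supported matrix mask in ℤ → ℝ^{(d+1)×(d+1)} whose convolution operator annihilates the vector sequences v_f for all f ∈ V_{d,Λ} = span{1,…,x^p, e^{±λ_1 x}, …, e^{±λ_r x}} with d = p + 2r. Then there exists a finitely supported matrix mask B with C = B * H_{d,Λ}, i.e., C*(z) = B*(z) H*_{d,Λ}(z), where H_{d,Λ} is the cancellation operator with symbol H*_{d,Λ}(z) = [[T*_p(z), Q*(z)],[0, R*(z)]] and R*(z) = L_{d,Λ} diag(z⁻¹ − e^{±λ_j}) L_{d,Λ}⁻¹. -/

import Mathlib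

/-- The symbol of a finitely supported matrix sequence, `H*(z) = Σ_α z^α H(α)`. -/
noncomputable def matSymbol {m : ℕ} (H : ℤ → Matrix (Fin m) (Fin m) ℝ) (z : ℝ) :
    Matrix (Fin m) (Fin m) ℝ :=
  ∑ᶠ α : ℤ, z ^ α • H α

/-- The `2r` signed nodes `λ_1, -λ_1, …, λ_r, -λ_r`. -/
def signedNodes (r : ℕ) (lam : Fin r → ℝ) : Fin (2 * r) → ℝ :=
  fun c =>
    if c.val % 2 = 0 then lam ⟨c.val / 2, by omega⟩ else -lam ⟨c.val / 2, by omega⟩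

/-- The transposed Vandermonde-type matrix `L_{d,Λ}` with columns the powers
`p+1, …, d` of the signed nodes. -/
noncomputable def Lmat (p r : ℕ) (lam : Fin r → ℝ) :
    Matrix (Fin (2 * r)) (Fin (2 * r)) ℝ :=
  Matrix.of fun i c => signedNodes r lam c ^ (p + 1 + (i : ℕ))

/-- The diagonal matrix `diag(z⁻¹ - e^{±λ_j})`. -/
noncomputable def DeltaLam (r : ℕ) (lam : Fin r → ℝ) (z : ℝ) :
    Matrix (Fin (2 * r)) (Fin (2 * r)) ℝ :=
  Matrix.diagonal fun c => z⁻¹ - Real.exp (signedNodes r lam c)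

lemma aux_indep (g : ℤ → ℝ) (hg : (Function.support g).Finite)
    (h : ∀ z : ℝ, z ≠ 0 → ∑ᶠ α : ℤ, z ^ α * g α = 0) : g = 0 := by
  have hli := (linearIndependent_monoidHom ℝˣ ℝ).comp
    (fun α : ℤ => (Units.coeHom ℝ).comp (zpowGroupHom α)) (by
      intro a b hab
      have := DFunLike.congr_fun hab (Units.mk0 (2:ℝ) two_ne_zero)
      simp at this
      exact this)
  rw [linearIndependent_iff'] at hli
  have := hli hg.toFinset g (by
    funext z
    have h1 := h z z.ne_zero
    rw [finsum_eq_sum_of_support_subset (s := hg.toFinset)] at h1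
    · simp only [Finset.sum_apply, Pi.smul_apply, smul_eq_mul, Function.comp]
      simp only [MonoidHom.comp_apply, Units.coeHom_apply, zpowGroupHom_apply, Units.val_zpow_eq_zpow_val]
      rw [Pi.zero_apply, ← h1]
      exact Finset.sum_congr rfl fun i _ => mul_comm _ _
    · intro α hα
      simp at hα ⊢
      exact hα.2)
  funext α
  by_contra hα
  exact hα (this α (by simpa using hα))

lemma aux_symbol_support {m : ℕ} (H : ℤ → Matrix (Fin m) (Fin m) ℝ) (z : ℝ)
    (hH : (Function.support H).Finite) :
    (Function.support fun α : ℤ => z ^ α • H α).Finite :=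
  hH.subset fun α hα h0 => hα (by simp [h0])

lemma aux_symbol_apply {m : ℕ} (H : ℤ → Matrix (Fin m) (Fin m) ℝ)
    (hH : (Function.support H).Finite) (z : ℝ) (j k : Fin m) :
    matSymbol H z j k = ∑ᶠ α : ℤ, z ^ α * H α j k := by
  have := (Matrix.entryAddMonoidHom ℝ j k).map_finsum (aux_symbol_support H z hH)
  simpa [matSymbol] using this

lemma aux_inj {m : ℕ} (H G : ℤ → Matrix (Fin m) (Fin m) ℝ)
    (hH : (Function.support H).Finite) (hG : (Function.support G).Finite)
    (h : ∀ z : ℝ, z ≠ 0 → matSymbol H z = matSymbol G z) : H = G := by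
  funext α
  ext j k
  have e (F : ℤ → Matrix (Fin m) (Fin m) ℝ) (hF : (Function.support F).Finite) :
      (Function.support fun α => F α j k).Finite :=
    hF.subset fun α hα h0 => hα (by simp [h0])
  have := aux_indep (fun α => H α j k - G α j k)
    (((e H hH).union (e G hG)).subset (Function.support_sub _ _)) (by
      intro z hz
      have h1 := congrFun (congrFun (h z hz) j) k
      rw [aux_symbol_apply H hH, aux_symbol_apply G hG, ← sub_eq_zero, ← finsum_sub_distrib] at h1
      · simpa [mul_sub] using h1
      · exact (e H hH).subset fun α hα h0 => hα (by simp [h0])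
      · exact (e G hG).subset fun α hα h0 => hα (by simp [h0]))
  exact sub_eq_zero.mp (congrFun this α)

/-- The two-term mask `z⁻¹ - M`. -/
def auxMask {m : ℕ} (M : Matrix (Fin m) (Fin m) ℝ) : ℤ → Matrix (Fin m) (Fin m) ℝ :=
  fun α => if α = -1 then 1 else if α = 0 then -M else 0

lemma auxMask_support {m : ℕ} (M : Matrix (Fin m) (Fin m) ℝ) :
    Function.support (auxMask M) ⊆ (({-1, 0} : Finset ℤ) : Set ℤ) := by
  intro α hα
  by_contra h
  simp at h
  exact hα (by simp [auxMask, h.1, h.2])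

lemma auxMask_symbol {m : ℕ} (M : Matrix (Fin m) (Fin m) ℝ) (z : ℝ) :
    matSymbol (auxMask M) z = z⁻¹ • 1 - M := by
  unfold matSymbol
  rw [finsum_eq_sum_of_support_subset (s := {-1, 0})]
  · simp [auxMask, sub_eq_add_neg]
  · intro α hα
    exact auxMask_support M fun h0 => hα (by simp [h0])

lemma aux_Lmat (p r : ℕ) (lam : Fin r → ℝ) (hne : ∀ j, lam j ≠ 0)
    (hdist : ∀ i j, i ≠ j → lam i ≠ lam j ∧ lam i ≠ -lam j) :
    IsUnit (Lmat p r lam).det := by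
  have hinj : Function.Injective (signedNodes r lam) := by
    intro a b hab
    by_contra hne'
    have hv : a.val ≠ b.val := fun h => hne' (Fin.ext h)
    unfold signedNodes at hab
    by_cases hq : a.val / 2 = b.val / 2
    · have e : (⟨a.val / 2, by omega⟩ : Fin r) = ⟨b.val / 2, by omega⟩ := Fin.ext hq
      have h0 := hne ⟨b.val / 2, by omega⟩
      rw [e] at hab
      split_ifs at hab
      · omega
      · exact h0 (by linarith)
      · exact h0 (by linarith)
      · omega
    · have h0 := hdist ⟨a.val / 2, by omega⟩ ⟨b.val / 2, by omega⟩ (fun h => hq (congrArg Fin.val h))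
      split_ifs at hab
      · exact h0.1 hab
      · exact h0.2 hab
      · exact h0.2 (by linarith)
      · exact h0.1 (by linarith)
  have h0 : ∀ c, signedNodes r lam c ≠ 0 := by
    intro c
    unfold signedNodes
    split_ifs
    · exact hne _
    · exact neg_ne_zero.mpr (hne _)
  have e : Lmat p r lam = (Matrix.vandermonde (signedNodes r lam)).transpose *
      Matrix.diagonal (fun c => signedNodes r lam c ^ (p+1)) := by
    ext i c
    simp [Lmat, Matrix.mul_diagonal, Matrix.vandermonde, pow_add, mul_comm]
  rw [e, Matrix.det_mul, Matrix.det_transpose, Matrix.det_diagonal, isUnit_iff_ne_zero]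
  exact mul_ne_zero (Matrix.det_vandermonde_ne_zero_iff.mpr hinj)
    (Finset.prod_ne_zero_iff.mpr fun c _ => pow_ne_zero _ (h0 c))

lemma aux_Rdiff (p r : ℕ) (lam : Fin r → ℝ) (hL : IsUnit (Lmat p r lam).det) (z : ℝ) :
    Lmat p r lam * DeltaLam r lam z * (Lmat p r lam)⁻¹ =
    Lmat p r lam * DeltaLam r lam 1 * (Lmat p r lam)⁻¹ + (z⁻¹ - 1) • 1 := by
  have e : DeltaLam r lam z = DeltaLam r lam 1 + (z⁻¹ - 1) • 1 := by
    ext i j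
    by_cases h : i = j
    · subst h; simp [DeltaLam]
    · simp [DeltaLam, h]
  rw [e, mul_add, add_mul]
  simp [Matrix.mul_nonsing_inv _ hL]

/-- Abstract division step. -/
lemma aux_division {m : ℕ} (M : Matrix (Fin m) (Fin m) ℝ) (C : ℤ → Matrix (Fin m) (Fin m) ℝ)
    (hC : (Function.support C).Finite)
    (h0 : ∀ α : ℤ, (∀ β, C β ≠ 0 → β ≤ α) → ∑ᶠ k : ℕ, C (α - k) * M ^ k = 0) :
    ∃ B : ℤ → Matrix (Fin m) (Fin m) ℝ, (Function.support B).Finite ∧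
      ∀ α, C α = B (α + 1) - B α * M := by
  have hfin : ∀ α : ℤ, (Function.support fun k : ℕ => C (α - k) * M ^ k).Finite := by
    intro α
    refine (hC.preimage (f := fun k : ℕ => α - (k:ℤ)) ?_).subset ?_
    · intro a _ b _ h
      simpa using h
    · intro k hk h0
      exact hk (by simp [h0])
  obtain ⟨u, hu⟩ := hC.bddAbove
  obtain ⟨l, hl⟩ := hC.bddBelow
  refine ⟨fun α => ∑ᶠ k : ℕ, C (α - 1 - k) * M ^ k, ?_, ?_⟩
  · refine (Set.finite_Icc l (u+1)).subset ?_
    intro α hα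
    rw [Set.mem_Icc]
    by_contra hcon
    rw [not_and_or] at hcon
    apply hα
    rcases hcon with h | h
    · refine finsum_eq_zero_of_forall_eq_zero fun k => ?_
      have : C (α - 1 - k) = 0 := by
        by_contra hc
        have := hl hc
        omega
      simp [this]
    · refine h0 (α - 1) fun β hβ => ?_
      have := hu hβ
      omega
  · intro α
    have e : ∑ᶠ k : ℕ, C (α - k) * M ^ k = C α + (∑ᶠ k : ℕ, C (α - 1 - k) * M ^ k) * M := by
      obtain ⟨N, hN⟩ := (hfin α).bddAbove
      obtain ⟨N', hN'⟩ := (hfin (α - 1)).bddAbove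
      rw [finsum_eq_sum_of_support_subset (s := Finset.range (max N N' + 1 + 1)),
        finsum_eq_sum_of_support_subset (s := Finset.range (max N N' + 1)),
        Finset.sum_range_succ', Finset.sum_mul, add_comm]
      · congr 1
        · simp
        · refine Finset.sum_congr rfl fun k _ => ?_
          rw [pow_succ, mul_assoc]
          congr 2
          push_cast
          ring
      · intro k hk
        have := hN' hk
        simp
        omega
      · intro k hk
        have := hN hk
        simp
        omega
    show C α = (∑ᶠ k : ℕ, C (α + 1 - 1 - k) * M ^ k) - _
    simp only [add_sub_cancel_right]
    rw [e]
    simp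

lemma aux_symbol_factor {m : ℕ} (M : Matrix (Fin m) (Fin m) ℝ) (C B : ℤ → Matrix (Fin m) (Fin m) ℝ)
    (hB : (Function.support B).Finite) (hCB : ∀ α, C α = B (α + 1) - B α * M) (z : ℝ) (hz : z ≠ 0) :
    matSymbol C z = matSymbol B z * (z⁻¹ • 1 - M) := by
  have s1 := aux_symbol_support B z hB
  have e1 : matSymbol B z * M = ∑ᶠ α : ℤ, (z ^ α • B α) * M :=
    (AddMonoidHom.mulRight M).map_finsum s1
  have e2 : z⁻¹ • matSymbol B z = ∑ᶠ α : ℤ, z⁻¹ • (z ^ α • B α) := smul_finsum' _ s1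
  have e3 : ∑ᶠ α : ℤ, z⁻¹ • (z ^ α • B α) = ∑ᶠ α : ℤ, z ^ α • B (α + 1) := by
    rw [← finsum_comp_equiv (Equiv.addRight (1:ℤ))]
    refine finsum_congr fun α => ?_
    simp only [Equiv.coe_addRight]
    rw [smul_smul, zpow_add_one₀ hz, mul_comm, mul_assoc, mul_inv_cancel₀ hz, mul_one]
  rw [mul_sub, e1, Matrix.mul_smul, mul_one, e2, e3, ← finsum_sub_distrib]
  · unfold matSymbol
    refine finsum_congr fun α => ?_
    rw [hCB, smul_sub, Matrix.smul_mul]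
  · refine (hB.preimage (f := fun α : ℤ => α + 1) ?_).subset ?_
    · intro a _ b _ h
      simpa using h
    · intro α hα h0
      exact hα (by simp [h0])
  · exact s1.subset fun α hα h0 => hα (by simp [h0])

lemma aux_conv {m : ℕ} (M : Matrix (Fin m) (Fin m) ℝ) (B : ℤ → Matrix (Fin m) (Fin m) ℝ) (α : ℤ) :
    ∑ᶠ β : ℤ, B β * auxMask M (α - β) = B (α + 1) - B α * M := by
  rw [finsum_eq_sum_of_support_subset (s := {α + 1, α})]
  · rw [Finset.sum_pair (by simp)]
    simp [auxMask, sub_eq_add_neg]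
  · intro β hβ
    have : auxMask M (α - β) ≠ 0 := fun h => hβ (by simp [h])
    have := auxMask_support M this
    simp at this ⊢
    omega

/-- From the shift relation to the remainder acting on `v 0`. -/
lemma aux_remainder {m : ℕ} (M : Matrix (Fin m) (Fin m) ℝ) (C : ℤ → Matrix (Fin m) (Fin m) ℝ)
    (hC : (Function.support C).Finite) (v : ℤ → Fin m → ℝ)
    (hv : ∀ k : ℕ, v (k + 1) = M.mulVec (v k)) (α : ℤ) (hα : ∀ β, C β ≠ 0 → β ≤ α)
    (h : ∑ᶠ β : ℤ, (C (α - β)).mulVec (v β) = 0) :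
    (∑ᶠ k : ℕ, C (α - k) * M ^ k).mulVec (v 0) = 0 := by
  have hp : ∀ k : ℕ, v k = (M ^ k).mulVec (v 0) := by
    intro k
    induction k with
    | zero => simp
    | succ k ih => rw [pow_succ', ← Matrix.mulVec_mulVec, ← ih, ← hv]; simp
  obtain ⟨l, hl⟩ := hC.bddBelow
  obtain ⟨N, hN⟩ : ∃ N : ℕ, α - l < N := ⟨(α - l + 1).toNat, by omega⟩
  rw [finsum_eq_sum_of_support_subset (s := Finset.range N)]
  · rw [finsum_eq_sum_of_support_subset (s := (Finset.range N).map Nat.castEmbedding)] at h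
    · rw [Finset.sum_map] at h
      rw [Matrix.sum_mulVec, ← h]
      refine Finset.sum_congr rfl fun k _ => ?_
      rw [← Matrix.mulVec_mulVec, ← hp]
      rfl
    · intro β hβ
      have hc : C (α - β) ≠ 0 := fun h => hβ (by simp [h])
      have h1 := hα _ hc
      have h2 := hl hc
      simp
      exact ⟨β.toNat, by omega, by omega⟩
  · intro k hk
    have hc : C (α - k) ≠ 0 := fun h => hk (by simp [h])
    have h2 := hl hc
    simp
    omega

lemma aux_iter_exp (e : ℝ) (k : ℕ) (x : ℝ) :
    iteratedDeriv k (fun x : ℝ => Real.exp (e * x)) x = e ^ k * Real.exp (e * x) := by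
  simp [iteratedDeriv_exp_const_mul]

lemma aux_iter_pow (n k : ℕ) (x : ℝ) :
    iteratedDeriv k (fun x : ℝ => x ^ n) x = n.descFactorial k * x ^ (n - k) := by
  simp

lemma aux_binom (d n j : ℕ) (hn : n ≤ d) (hj : j ≤ d) (x : ℝ) :
    (n.descFactorial j : ℝ) * (x + 1) ^ (n - j) =
      ∑ l ∈ Finset.range (d + 1), (if j ≤ l then (1 / ((l - j).factorial : ℝ)) else 0) *
        (n.descFactorial l * x ^ (n - l)) := by
  by_cases hjn : j ≤ n
  · obtain ⟨t, rfl⟩ := Nat.exists_eq_add_of_le hjn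
    obtain ⟨s, rfl⟩ := Nat.exists_eq_add_of_le hn
    rw [show j + t + s + 1 = j + (t + 1 + s) by ring, Finset.sum_range_add, Finset.sum_range_add,
      Finset.sum_eq_zero, Finset.sum_eq_zero (s := Finset.range s), add_comm x, add_pow]
    · simp only [Nat.add_sub_cancel_left, zero_add, add_zero, Finset.mul_sum]
      refine Finset.sum_congr rfl fun i hi => ?_
      rw [if_pos (by omega), Nat.add_sub_add_left]
      rw [show (j+t).descFactorial (j+i) = (j+t).descFactorial j * t.descFactorial i from ?_]
      · rw [Nat.descFactorial_eq_factorial_mul_choose t i]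
        have := Nat.factorial_ne_zero i
        push_cast
        field_simp
        simp
      · rw [← Nat.descFactorial_mul_descFactorial (n := j+t) (k := j) (m := j+i) (by omega)]
        simp [mul_comm]
    · intro i hi
      rw [Nat.descFactorial_of_lt (by omega)]
      simp
    · intro i hi
      rw [if_neg (by simp at hi; omega)]
      simp
  · rw [Nat.descFactorial_of_lt (by omega), Finset.sum_eq_zero]
    · simp
    · intro l _
      split_ifs
      · rw [Nat.descFactorial_of_lt (by omega)]; simp
      · simp

/-- If a finitely supported matrix mask `C` annihilates the derivative-vector sequences
`v_f` of all `f ∈ V_{d,Λ} = span{1,…,x^p, e^{±λ_j x}}` with `d = p + 2r`, then it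
factorizes as `C = B * H_{d,Λ}` through the cancellation operator `H_{d,Λ}`, whose
symbol has the block structure `[[T*_p(z), Q*(z)], [0, R*(z)]]` with
`R*(z) = L_{d,Λ} diag(z⁻¹ - e^{±λ_j}) L_{d,Λ}⁻¹`. -/
theorem annihilator_factorization
    (p r : ℕ) (lam : Fin r → ℝ) (hne : ∀ j, lam j ≠ 0)
    (hdist : ∀ i j, i ≠ j → lam i ≠ lam j ∧ lam i ≠ -lam j)
    (H : ℤ → Matrix (Fin (p + 2 * r + 1)) (Fin (p + 2 * r + 1)) ℝ)
    (hHfin : (Function.support H).Finite)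
    -- the upper left block of `H*` is the Taylor symbol `T*_p(z)`
    (hTaylor : ∀ z : ℝ, z ≠ 0 → ∀ j k : Fin (p + 2 * r + 1),
      j.val ≤ p → k.val ≤ p →
      matSymbol H z j k =
        if j = k then z⁻¹ - 1
        else if j.val < k.val then -(1 / (Nat.factorial (k.val - j.val))) else 0)
    -- the lower left block of `H*` vanishes
    (hZero : ∀ z : ℝ, z ≠ 0 → ∀ j k : Fin (p + 2 * r + 1),
      p < j.val → k.val ≤ p → matSymbol H z j k = 0)
    -- the upper right block `Q*` is constant in `z`
    (hQconst : ∀ z : ℝ, z ≠ 0 → ∀ j k : Fin (p + 2 * r + 1),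
      j.val ≤ p → p < k.val → matSymbol H z j k = matSymbol H 1 j k)
    -- the lower right block is `R*(z) = L diag(z⁻¹ - e^{±λ_j}) L⁻¹`
    (hR : ∀ z : ℝ, z ≠ 0 → ∀ j k : Fin (p + 2 * r + 1),
      ∀ hj : p < j.val, ∀ hk : p < k.val,
      matSymbol H z j k =
        (Lmat p r lam * DeltaLam r lam z * (Lmat p r lam)⁻¹)
          ⟨j.val - (p + 1), by omega⟩ ⟨k.val - (p + 1), by omega⟩)
    -- `Q*` is determined by the conditions `H*(e^{∓λ_j})(1, ±λ_j, …, (±λ_j)^d)ᵀ = 0`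
    (hann : ∀ j : Fin r, ∀ e : ℝ, e = lam j ∨ e = -lam j →
      (matSymbol H (Real.exp (-e))).mulVec (fun k => e ^ (k : ℕ)) = 0)
    (C : ℤ → Matrix (Fin (p + 2 * r + 1)) (Fin (p + 2 * r + 1)) ℝ)
    (hCfin : (Function.support C).Finite)
    -- `C` annihilates the vector sequences `v_f`, `f ∈ V_{d,Λ}`
    (hC : ∀ f : ℝ → ℝ,
      f ∈ Submodule.span ℝ
        ((⋃ k ∈ Finset.range (p + 1), {fun x : ℝ => x ^ k}) ∪
          (⋃ j : Fin r,
            {fun x : ℝ => Real.exp (lam j * x),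
             fun x : ℝ => Real.exp (-lam j * x)})) →
      ∀ α : ℤ,
        ∑ᶠ β : ℤ, (C (α - β)).mulVec (fun k => iteratedDeriv (k : ℕ) f (β : ℝ)) = 0) :
    ∃ B : ℤ → Matrix (Fin (p + 2 * r + 1)) (Fin (p + 2 * r + 1)) ℝ,
      (Function.support B).Finite ∧
      (∀ α : ℤ, C α = ∑ᶠ β : ℤ, B β * H (α - β)) ∧
      (∀ z : ℝ, z ≠ 0 → matSymbol C z = matSymbol B z * matSymbol H z) := by
  have hL := aux_Lmat p r lam hne hdist
  set M : Matrix (Fin (p + 2 * r + 1)) (Fin (p + 2 * r + 1)) ℝ := 1 - matSymbol H 1 with hM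
  have hsym : ∀ z : ℝ, z ≠ 0 → matSymbol H z = z⁻¹ • 1 - M := by
    intro z hz
    ext j k
    have key : matSymbol H z j k = matSymbol H 1 j k + (z⁻¹ - 1) * (1 : Matrix _ _ ℝ) j k := by
      by_cases hj : j.val ≤ p <;> by_cases hk : k.val ≤ p
      · rw [hTaylor z hz j k hj hk, hTaylor 1 one_ne_zero j k hj hk]
        by_cases hjk : j = k
        · subst hjk; simp
        · simp [hjk]
      · have hjk : j ≠ k := by rintro rfl; exact hk hj
        rw [hQconst z hz j k hj (by omega), Matrix.one_apply_ne hjk]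
        simp
      · have hjk : j ≠ k := by rintro rfl; exact hj hk
        rw [hZero z hz j k (by omega) hk, hZero 1 one_ne_zero j k (by omega) hk,
          Matrix.one_apply_ne hjk]
        simp
      · rw [hR z hz j k (by omega) (by omega), hR 1 one_ne_zero j k (by omega) (by omega),
          aux_Rdiff p r lam hL z, Matrix.add_apply, Matrix.smul_apply, smul_eq_mul]
        congr 2
        by_cases hjk : j = k
        · subst hjk; simp
        · rw [Matrix.one_apply_ne hjk, Matrix.one_apply_ne]
          intro h
          apply hjk
          have := congrArg Fin.val h
          simp only at this
          exact Fin.ext (by omega)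
    rw [key]
    simp [hM]
    ring
  have hHM : H = auxMask M := aux_inj H _ hHfin
    ((Finset.finite_toSet _).subset (auxMask_support M)) fun z hz => by
      rw [hsym z hz, auxMask_symbol]
  -- shift relations
  have hexp : ∀ e : ℝ, (∃ j, e = lam j ∨ e = -lam j) →
      M.mulVec (fun k => e ^ (k : ℕ)) = Real.exp e • fun k : Fin (p + 2 * r + 1) => e ^ (k : ℕ) := by
    rintro e ⟨j, hj⟩
    have := hann j e hj
    rw [hsym _ (Real.exp_ne_zero _), Matrix.sub_mulVec, Matrix.smul_mulVec, Matrix.one_mulVec,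
      sub_eq_zero, Real.exp_neg, inv_inv] at this
    exact this.symm
  have hM1 : ∀ j k : Fin (p + 2 * r + 1), k.val ≤ p →
      M j k = if j.val ≤ k.val then (1 / ((k.val - j.val).factorial : ℝ)) else 0 := by
    intro j k hk
    by_cases hj : j.val ≤ p
    · rw [hM, Matrix.sub_apply, hTaylor 1 one_ne_zero j k hj hk]
      by_cases hjk : j = k
      · subst hjk; simp
      · have : j.val ≠ k.val := fun h => hjk (Fin.ext h)
        rw [Matrix.one_apply_ne hjk, if_neg hjk]
        by_cases hlt : j.val < k.val
        · rw [if_pos hlt, if_pos hlt.le]; ring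
        · rw [if_neg hlt, if_neg (by omega)]; ring
    · have hjk : j ≠ k := by rintro rfl; exact hj hk
      rw [hM, Matrix.sub_apply, hZero 1 one_ne_zero j k (by omega) hk, Matrix.one_apply_ne hjk,
        if_neg (by omega)]
      simp
  have hpow : ∀ n : ℕ, n ≤ p → ∀ x : ℝ,
      M.mulVec (fun k : Fin (p + 2 * r + 1) => (n.descFactorial k : ℝ) * x ^ (n - (k : ℕ))) =
        fun k : Fin (p + 2 * r + 1) => (n.descFactorial k : ℝ) * (x + 1) ^ (n - (k : ℕ)) := by
    intro n hn x
    funext j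
    rw [aux_binom (p + 2 * r) n j (by omega) (by omega) x, Finset.sum_range]
    simp only [Matrix.mulVec, dotProduct]
    refine Finset.sum_congr rfl fun k _ => ?_
    by_cases hk : k.val ≤ p
    · rw [hM1 j k hk]
    · rw [Nat.descFactorial_of_lt (by omega)]; simp
  have hrem : ∀ α : ℤ, (∀ β, C β ≠ 0 → β ≤ α) → ∑ᶠ k : ℕ, C (α - k) * M ^ k = 0 := by
    intro α hα
    set R := ∑ᶠ k : ℕ, C (α - k) * M ^ k with hRdef
    have hRe : ∀ e : ℝ, (∃ j, e = lam j ∨ e = -lam j) →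
        R.mulVec (fun k => e ^ (k : ℕ)) = 0 := by
      intro e he
      have hmem : (fun x : ℝ => Real.exp (e * x)) ∈ Submodule.span ℝ
        ((⋃ k ∈ Finset.range (p + 1), {fun x : ℝ => x ^ k}) ∪
          (⋃ j : Fin r,
            {fun x : ℝ => Real.exp (lam j * x),
             fun x : ℝ => Real.exp (-lam j * x)})) := by
        apply Submodule.subset_span
        right
        obtain ⟨j, rfl | rfl⟩ := he
        · exact Set.mem_iUnion.mpr ⟨j, Or.inl rfl⟩
        · exact Set.mem_iUnion.mpr ⟨j, Or.inr rfl⟩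
      have h1 := hC _ hmem α
      simp only [aux_iter_exp] at h1
      have h2 := aux_remainder M C hCfin
        (fun β k => e ^ (k : ℕ) * Real.exp (e * (β : ℝ))) (by
          intro n
          have e1 : (fun k : Fin (p + 2 * r + 1) => e ^ (k : ℕ) * Real.exp (e * ((n : ℤ) : ℝ))) =
            Real.exp (e * n) • fun k : Fin (p + 2 * r + 1) => e ^ (k : ℕ) := by
            funext k; simp [mul_comm]
          rw [e1, Matrix.mulVec_smul, hexp e he]
          funext k
          simp [mul_add, Real.exp_add]
          ring) α hα h1
      simpa using h2
    have hRp : ∀ j k : Fin (p + 2 * r + 1), k.val ≤ p → R j k = 0 := by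
      intro j k hk
      have hmem : (fun x : ℝ => x ^ k.val) ∈ Submodule.span ℝ
        ((⋃ k ∈ Finset.range (p + 1), {fun x : ℝ => x ^ k}) ∪
          (⋃ j : Fin r,
            {fun x : ℝ => Real.exp (lam j * x),
             fun x : ℝ => Real.exp (-lam j * x)})) := by
        apply Submodule.subset_span
        left
        simp only [Set.mem_iUnion]
        exact ⟨k.val, by simp; omega, rfl⟩
      have h1 := hC _ hmem α
      simp only [aux_iter_pow] at h1
      have h2 := aux_remainder M C hCfin
        (fun β i => (k.val.descFactorial i : ℝ) * (β : ℝ) ^ (k.val - (i : ℕ))) (by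
          intro n
          rw [hpow k.val hk]
          simp) α hα h1
      have e1 : (fun i : Fin (p + 2 * r + 1) =>
          (k.val.descFactorial i : ℝ) * ((0 : ℤ) : ℝ) ^ (k.val - (i : ℕ))) =
          Pi.single k (k.val.factorial : ℝ) := by
        funext i
        by_cases hik : i = k
        · subst hik; simp [Nat.descFactorial_self]
        · rw [Pi.single_eq_of_ne hik]
          have : i.val ≠ k.val := fun h => hik (Fin.ext h)
          by_cases hlt : i.val < k.val
          · simp; right; omega
          · rw [Nat.descFactorial_of_lt (by omega)]; simp
      have h2b : R.mulVec (Pi.single k (k.val.factorial : ℝ)) = 0 := by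
        rw [← e1]
        exact h2
      have h3 := congrFun h2b j
      rw [Matrix.mulVec_single] at h3
      simpa [Nat.factorial_ne_zero] using h3
    -- the remaining columns
    have hq : ∀ j : Fin (p + 2 * r + 1),
        (fun i : Fin (2 * r) => R j ⟨p + 1 + i.val, by omega⟩) = 0 := by
      intro j
      refine Matrix.eq_zero_of_vecMul_eq_zero hL.ne_zero ?_
      funext c
      have hc : ∃ j, signedNodes r lam c = lam j ∨ signedNodes r lam c = -lam j := by
        refine ⟨⟨c.val / 2, by omega⟩, ?_⟩
        unfold signedNodes
        split_ifs
        · exact Or.inl rfl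
        · exact Or.inr rfl
      have h1 := congrFun (hRe _ hc) j
      simp only [Matrix.mulVec, dotProduct, Pi.zero_apply] at h1
      let g : ℕ → ℝ := fun n => if h : n < p + 2 * r + 1 then R j ⟨n, h⟩ * signedNodes r lam c ^ n else 0
      have h2 : ∑ n ∈ Finset.range (p + 1 + 2 * r), g n = 0 := by
        rw [show p + 1 + 2 * r = p + 2 * r + 1 by ring, Finset.sum_range, ← h1]
        refine Finset.sum_congr rfl fun k _ => ?_
        simp only [g]
        rw [dif_pos k.isLt]
      rw [Finset.sum_range_add, Finset.sum_eq_zero, zero_add, Finset.sum_range] at h2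
      · rw [Pi.zero_apply, ← h2]
        simp only [Matrix.vecMul, dotProduct]
        refine Finset.sum_congr rfl fun i _ => ?_
        have : p + 1 + i.val < p + 2 * r + 1 := by omega
        simp only [g]
        rw [dif_pos this]
        simp [Lmat]
      · intro n hn
        simp only [Finset.mem_range] at hn
        simp only [g]
        rw [dif_pos (by omega), hRp _ _ (by simp; omega), zero_mul]
    ext j k
    by_cases hk : k.val ≤ p
    · exact hRp j k hk
    · have := congrFun (hq j) ⟨k.val - (p + 1), by omega⟩
      simp only [Pi.zero_apply] at this
      rw [Matrix.zero_apply, ← this]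
      congr 1
      exact Fin.ext (by simp; omega)
  obtain ⟨B, hB, hCB⟩ := aux_division M C hCfin hrem
  refine ⟨B, hB, ?_, ?_⟩
  · intro α
    rw [hHM, aux_conv, hCB]
  · intro z hz
    rw [hsym z hz, aux_symbol_factor M C B hB hCB z hz]
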